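/- gcld(ω, λ) = 1 if and only if the ν × ν matrix with entries N_{−i}(α_{k_j})·σ^{−i}(η_{k_j})·σ^{−i}(e_j), for 0 ≤ i ≤ ν−1 and 1 ≤ j ≤ ν, has nonzero determinant. -/

import Mathlib

/-- `δ` is a `σ`-derivation of the field `L`. -/
def IsSigmaDerivation {L : Type*} [Field L] (σ : L ≃+* L) (δ : L → L) : Prop :=
  (∀ a b : L, δ (a + b) = δ a + δ b) ∧ ∀ a b : L, δ (a * b) = σ a * δ b + δ a * b

/-- The ring `R`, together with the embedding of constants `C : L →+* R` and the
element `X`, is the Ore extension `L[x;σ,δ]`: the twisting rule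
`X * C a = C (σ a) * X + C (δ a)` holds and every element of `R` is, in a unique way,
a left `L`-linear combination of the powers of `X`. -/
structure IsOreExtension {L : Type*} [Field L] (σ : L ≃+* L) (δ : L → L)
    (R : Type*) [Ring R] (C : L →+* R) (X : R) : Prop where
  twist : ∀ a : L, X * C a = C (σ a) * X + C (δ a)
  repr_unique : ∀ r : R, ∃! f : ℕ →₀ L, r = f.sum fun n a => C a * X ^ n

/-- The degree of an Ore polynomial (`⊥` for the zero polynomial). -/
noncomputable def IsOreExtension.deg {L : Type*} [Field L] {σ : L ≃+* L} {δ : L → L}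
    {R : Type*} [Ring R] {C : L →+* R} {X : R}
    (H : IsOreExtension σ δ R C X) (r : R) : WithBot ℕ :=
  (H.repr_unique r).exists.choose.support.max

/-- `f` is a right divisor of `g` : `g = u * f` for some `u`. -/
def RDvd {R : Type*} [Ring R] (f g : R) : Prop := ∃ u, g = u * f

/-- `f` is a left divisor of `g` : `g = f * u` for some `u`. -/
def LDvd {R : Type*} [Ring R] (f g : R) : Prop := ∃ u, g = f * u

/-- `m` is a least common left multiple of the family `f`. -/
def IsLclm {R : Type*} [Ring R] {ι : Type*} (f : ι → R) (m : R) : Prop :=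
  (∀ i, RDvd (f i) m) ∧ ∀ m' : R, (∀ i, RDvd (f i) m') → RDvd m m'

/-- `m` is a least common right multiple of the family `f`. -/
def IsLcrm {R : Type*} [Ring R] {ι : Type*} (f : ι → R) (m : R) : Prop :=
  (∀ i, LDvd (f i) m) ∧ ∀ m' : R, (∀ i, LDvd (f i) m') → LDvd m m'

/-- `gcld (f, g) = 1`, i.e. `fR + gR = R`. -/
def LCoprime {R : Type*} [Ring R] (f g : R) : Prop := ∃ a b : R, f * a + g * b = 1

/-- `gcrd (f, g) = 1`, i.e. `Rf + Rg = R`. -/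
def RCoprime {R : Type*} [Ring R] (f g : R) : Prop := ∃ a b : R, a * f + b * g = 1

/-- The negative partial norm `N_{-i}(a) = a · σ⁻¹ a · … · σ^{-i+1} a`. -/
def Nneg {L : Type*} [Field L] (σ : L ≃+* L) (i : ℕ) (a : L) : L :=
  ∏ t ∈ Finset.range i, (⇑σ.symm)^[t] a

namespace IsOreExtension

variable {L : Type*} [Field L] {σ : L ≃+* L} {R : Type*} [Ring R] {C : L →+* R} {X : R}

section Coefficients

variable (H : IsOreExtension σ (fun _ => 0) R C X)

/-- The left coefficients of a skew polynomial. -/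
noncomputable def coeffs (r : R) : ℕ →₀ L := (H.repr_unique r).exists.choose

include H

lemma sum_coeffs (r : R) : (H.coeffs r).sum (fun n a => C a * X ^ n) = r :=
  (H.repr_unique r).exists.choose_spec.symm

lemma coeffs_eq {r : R} {f : ℕ →₀ L} (h : r = f.sum fun n a => C a * X ^ n) :
    H.coeffs r = f :=
  (H.repr_unique r).unique (H.sum_coeffs r).symm h

lemma coeffs_add (r s : R) : H.coeffs (r + s) = H.coeffs r + H.coeffs s := by
  apply H.coeffs_eq
  rw [Finsupp.sum_add_index' (by simp) (by simp [add_mul]), H.sum_coeffs, H.sum_coeffs]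

lemma coeffs_zero : H.coeffs 0 = 0 := H.coeffs_eq (by simp)

lemma coeffs_sum {ι : Type*} (s : Finset ι) (f : ι → R) :
    H.coeffs (∑ i ∈ s, f i) = ∑ i ∈ s, H.coeffs (f i) :=
  map_sum (AddMonoidHom.mk ⟨H.coeffs, H.coeffs_zero⟩ H.coeffs_add) f s

lemma coeffs_sub (r s : R) : H.coeffs (r - s) = H.coeffs r - H.coeffs s := by
  rw [eq_sub_iff_add_eq, ← H.coeffs_add, sub_add_cancel]

lemma eq_zero_of_coeffs {r : R} (h : H.coeffs r = 0) : r = 0 := by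
  rw [← H.sum_coeffs r, h, Finsupp.sum_zero_index]

lemma coeffs_monomial (a : L) (n : ℕ) : H.coeffs (C a * X ^ n) = Finsupp.single n a :=
  H.coeffs_eq (by simp)

lemma X_mul_C (a : L) : X * C a = C (σ a) * X := by simpa using H.twist a

lemma X_pow_mul_C (n : ℕ) (a : L) : X ^ n * C a = C ((⇑σ)^[n] a) * X ^ n := by
  induction n generalizing a with
  | zero => simp
  | succ n ih =>
    rw [pow_succ, mul_assoc, H.X_mul_C, ← mul_assoc, ih, mul_assoc, Function.iterate_succ_apply]

lemma C_mul_X_symm (a : L) : C a * X = X * C (σ.symm a) := by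
  rw [H.X_mul_C, RingEquiv.apply_symm_apply]

lemma monomial_mul_monomial (a b : L) (m n : ℕ) :
    C a * X ^ m * (C b * X ^ n) = C (a * (⇑σ)^[m] b) * X ^ (m + n) := by
  rw [mul_assoc, ← mul_assoc (X ^ m), H.X_pow_mul_C, map_mul, pow_add]
  simp only [mul_assoc]

lemma induction_right {P : R → Prop} (one : P 1) (add : ∀ r s, P r → P s → P (r + s))
    (mul_C : ∀ r a, P r → P (r * C a)) (mul_X : ∀ r, P r → P (r * X)) (r : R) : P r := by
  have zero : P 0 := by simpa using mul_C 1 0 one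
  rw [← H.sum_coeffs r]
  refine Finset.sum_induction _ P add zero fun n hn => ?_
  clear hn
  change P (C (H.coeffs r n) * X ^ n)
  generalize H.coeffs r n = a
  induction n with
  | zero => simpa using mul_C 1 a one
  | succ n ih => simpa [pow_succ, mul_assoc] using mul_X _ ih

lemma induction_left {P : R → Prop} (one : P 1) (add : ∀ r s, P r → P s → P (r + s))
    (C_mul : ∀ r a, P r → P (C a * r)) (X_mul : ∀ r, P r → P (X * r)) (r : R) : P r := by
  have zero : P 0 := by simpa using C_mul 1 0 one
  rw [← H.sum_coeffs r]
  refine Finset.sum_induction _ P add zero fun n hn => C_mul _ _ ?_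
  clear hn
  induction n with
  | zero => simpa using one
  | succ n ih => simpa [pow_succ'] using X_mul _ ih

lemma coeffs_mul_monomial (r : R) (a : L) (k n : ℕ) :
    H.coeffs (r * (C a * X ^ k)) (n + k) = H.coeffs r n * (⇑σ)^[n] a := by
  conv_lhs => rw [← H.sum_coeffs r, Finsupp.sum, Finset.sum_mul, H.coeffs_sum]
  simp_rw [H.monomial_mul_monomial, H.coeffs_monomial]
  simp +contextual [Finsupp.finsetSum_apply, Finsupp.single_apply]

lemma coeffs_mul_C (r : R) (a : L) (n : ℕ) :
    H.coeffs (r * C a) n = H.coeffs r n * (⇑σ)^[n] a := by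
  simpa using H.coeffs_mul_monomial r a 0 n

end Coefficients

section NatDegree

variable (H : IsOreExtension σ (fun _ => 0) R C X)

/-- The degree of a skew polynomial as a natural number (`0` for the zero polynomial). -/
noncomputable def natDeg (r : R) : ℕ := (H.coeffs r).support.sup id

include H

lemma natDeg_eq_of_deg_eq {r : R} {n : ℕ} (h : H.deg r = n) : H.natDeg r = n := by
  change (H.coeffs r).support.max = n at h
  rw [natDeg]
  apply le_antisymm
  · exact Finset.sup_le fun i hi => WithBot.coe_le_coe.mp ((Finset.le_max hi).trans_eq h)
  · exact Finset.le_sup (f := id) (Finset.mem_of_max h)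

lemma coeffs_eq_zero_of_natDeg_lt {r : R} {n : ℕ} (h : H.natDeg r < n) : H.coeffs r n = 0 := by
  by_contra hn
  exact absurd (Finset.le_sup (f := id) (Finsupp.mem_support_iff.mpr hn)) (not_le.mpr h)

lemma natDeg_le {r : R} {m : ℕ} (h : ∀ n, m < n → H.coeffs r n = 0) : H.natDeg r ≤ m := by
  refine Finset.sup_le fun i hi => ?_
  by_contra hlt
  exact Finsupp.mem_support_iff.mp hi (h i (not_le.mp hlt))

lemma coeffs_natDeg_ne_zero {r : R} (hr : r ≠ 0) : H.coeffs r (H.natDeg r) ≠ 0 := by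
  have hne : (H.coeffs r).support.Nonempty := by
    rw [Finsupp.support_nonempty_iff]
    exact fun h => hr (H.eq_zero_of_coeffs h)
  obtain ⟨i, hi, h⟩ := Finset.exists_mem_eq_sup _ hne id
  rw [natDeg, h]
  exact Finsupp.mem_support_iff.mp hi

lemma coeffs_mul (r s : R) (k : ℕ) :
    H.coeffs (r * s) k = ∑ i ∈ (H.coeffs r).support, ∑ j ∈ (H.coeffs s).support,
      if i + j = k then H.coeffs r i * (⇑σ)^[i] (H.coeffs s j) else 0 := by
  conv_lhs => rw [← H.sum_coeffs r, ← H.sum_coeffs s, Finsupp.sum, Finsupp.sum,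
    Finset.sum_mul_sum]
  simp_rw [H.monomial_mul_monomial, H.coeffs_sum, H.coeffs_monomial, Finsupp.finsetSum_apply,
    Finsupp.single_apply]

lemma natDeg_mul_le (r s : R) : H.natDeg (r * s) ≤ H.natDeg r + H.natDeg s := by
  refine H.natDeg_le fun n hn => ?_
  rw [H.coeffs_mul]
  refine Finset.sum_eq_zero fun i hi => Finset.sum_eq_zero fun j hj => if_neg ?_
  have h₁ : i ≤ H.natDeg r := Finset.le_sup (f := id) hi
  have h₂ : j ≤ H.natDeg s := Finset.le_sup (f := id) hj
  omega

lemma coeffs_mul_natDeg_add (r s : R) :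
    H.coeffs (r * s) (H.natDeg r + H.natDeg s) =
      H.coeffs r (H.natDeg r) * (⇑σ)^[H.natDeg r] (H.coeffs s (H.natDeg s)) := by
  have hz : ∀ n, (⇑σ)^[n] 0 = 0 := fun n => Function.iterate_fixed (map_zero σ) n
  rw [H.coeffs_mul, Finset.sum_eq_single (H.natDeg r), Finset.sum_eq_single (H.natDeg s),
    if_pos rfl]
  · exact fun j _ hj => if_neg (by omega)
  · intro h
    simp [Finsupp.notMem_support_iff.mp h, hz]
  · refine fun i hi hne => Finset.sum_eq_zero fun j hj => if_neg ?_
    have h₁ : i ≤ H.natDeg r := Finset.le_sup (f := id) hi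
    have h₂ : j ≤ H.natDeg s := Finset.le_sup (f := id) hj
    omega
  · intro h
    simp [Finsupp.notMem_support_iff.mp h]

lemma coeffs_mul_natDeg_add_ne_zero {r s : R} (hr : r ≠ 0) (hs : s ≠ 0) :
    H.coeffs (r * s) (H.natDeg r + H.natDeg s) ≠ 0 := by
  rw [H.coeffs_mul_natDeg_add]
  refine mul_ne_zero (H.coeffs_natDeg_ne_zero hr) fun h => H.coeffs_natDeg_ne_zero hs ?_
  exact (σ.injective.iterate _) (h.trans (Function.iterate_fixed (map_zero σ) _).symm)

lemma mul_ne_zero' {r s : R} (hr : r ≠ 0) (hs : s ≠ 0) : r * s ≠ 0 := fun h =>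
  H.coeffs_mul_natDeg_add_ne_zero hr hs (by rw [h, H.coeffs_zero, Finsupp.zero_apply])

lemma noZeroDivisors : NoZeroDivisors R :=
  ⟨fun {_ _} h => by
    by_contra! hne
    exact H.mul_ne_zero' hne.1 hne.2 h⟩

lemma natDeg_mul {r s : R} (hr : r ≠ 0) (hs : s ≠ 0) :
    H.natDeg (r * s) = H.natDeg r + H.natDeg s :=
  le_antisymm (H.natDeg_mul_le r s)
    (Finset.le_sup (f := id)
      (Finsupp.mem_support_iff.mpr (H.coeffs_mul_natDeg_add_ne_zero hr hs)))

lemma coeffs_X_sub_C (a : L) (n : ℕ) :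
    H.coeffs (X - C a) n = (if n = 1 then 1 else 0) - if n = 0 then a else 0 := by
  have h₁ : H.coeffs X = Finsupp.single 1 1 := by simpa using H.coeffs_monomial 1 1
  have h₀ : H.coeffs (C a) = Finsupp.single 0 a := by simpa using H.coeffs_monomial a 0
  rw [H.coeffs_sub, h₁, h₀, Finsupp.sub_apply, Finsupp.single_apply, Finsupp.single_apply]
  simp only [eq_comm]

lemma X_sub_C_ne_zero (a : L) : X - C a ≠ 0 := fun h => by
  simpa [h, H.coeffs_zero] using H.coeffs_X_sub_C a 1

lemma natDeg_X_sub_C (a : L) : H.natDeg (X - C a) = 1 := by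
  apply le_antisymm
  · refine H.natDeg_le fun n hn => ?_
    rw [H.coeffs_X_sub_C, if_neg (by omega), if_neg (by omega), sub_zero]
  · refine Finset.le_sup (f := id) (Finsupp.mem_support_iff.mpr ?_)
    simp [H.coeffs_X_sub_C]

/-- Division with the quotient on the right. -/
lemma exists_eq_mul_add {d : R} (hd : d ≠ 0) (f : R) :
    ∃ q r, f = d * q + r ∧ (r = 0 ∨ H.natDeg r < H.natDeg d) := by
  set m := H.natDeg d
  suffices h : ∀ N : ℕ, ∀ f : R, (∀ n, N ≤ n → H.coeffs f n = 0) →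
      ∃ q r, f = d * q + r ∧ (r = 0 ∨ H.natDeg r < m) from
    h (H.natDeg f + 1) f fun n hn => H.coeffs_eq_zero_of_natDeg_lt hn
  intro N
  induction N with
  | zero =>
    intro f hf
    exact ⟨0, 0, by simpa using H.eq_zero_of_coeffs (Finsupp.ext fun n => hf n n.zero_le),
      Or.inl rfl⟩
  | succ N ih =>
    intro f hf
    rcases lt_or_ge N m with hN | hN
    · exact ⟨0, f, by simp, Or.inr ((H.natDeg_le fun n hn => hf n hn).trans_lt hN)⟩
    obtain ⟨k, rfl⟩ := Nat.exists_eq_add_of_le hN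
    obtain ⟨c, hc⟩ := (σ.surjective.iterate m) (H.coeffs f (m + k) / H.coeffs d m)
    have hcoeff : ∀ n, m + k ≤ n → H.coeffs (d * (C c * X ^ k)) n = H.coeffs f n := by
      intro n hn
      have hle : H.natDeg (C c * X ^ k) ≤ k :=
        H.natDeg_le fun i hi => by rw [H.coeffs_monomial, Finsupp.single_eq_of_ne (by omega)]
      rcases hn.eq_or_lt with rfl | hlt
      · rw [H.coeffs_mul_monomial, hc, mul_div_cancel₀ _ (H.coeffs_natDeg_ne_zero hd)]
      · rw [hf n hlt]
        exact H.coeffs_eq_zero_of_natDeg_lt ((H.natDeg_mul_le _ _).trans_lt (by omega))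
    obtain ⟨q, r, hqr, hr⟩ := ih (f - d * (C c * X ^ k)) fun n hn => by
      rw [H.coeffs_sub, Finsupp.sub_apply, hcoeff n hn, sub_self]
    exact ⟨C c * X ^ k + q, r, by rw [mul_add, add_assoc, ← hqr]; abel, hr⟩

end NatDegree

end IsOreExtension

namespace IsOreExtension

variable {L : Type*} [Field L] {σ : L ≃+* L} {R : Type*} [Ring R] {C : L →+* R} {X : R}

section Lclm

variable (H : IsOreExtension σ (fun _ => 0) R C X)

include H

/-- Division by `X - C a` with the quotient on the left. -/
lemma exists_eq_mul_X_sub_C_add (a : L) (f : R) : ∃ q c, f = q * (X - C a) + C c := by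
  induction f using H.induction_left with
  | one => exact ⟨0, 1, by simp⟩
  | add r s hr hs =>
    obtain ⟨q, c, rfl⟩ := hr
    obtain ⟨q', c', rfl⟩ := hs
    exact ⟨q + q', c + c', by rw [map_add]; noncomm_ring⟩
  | C_mul r b hr =>
    obtain ⟨q, c, rfl⟩ := hr
    exact ⟨C b * q, b * c, by rw [map_mul]; noncomm_ring⟩
  | X_mul r hr =>
    obtain ⟨q, c, rfl⟩ := hr
    refine ⟨X * q + C (σ c), σ c * a, ?_⟩
    rw [mul_add, H.X_mul_C, map_mul]
    noncomm_ring

lemma exists_common_left_multiple (f : R) (hf : f ≠ 0) (a : L) :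
    ∃ h, h ≠ 0 ∧ RDvd f h ∧ RDvd (X - C a) h ∧ H.natDeg h ≤ H.natDeg f + 1 := by
  obtain ⟨q, c, hq⟩ := H.exists_eq_mul_X_sub_C_add a f
  by_cases hc : c = 0
  · exact ⟨f, hf, ⟨1, (one_mul f).symm⟩, ⟨q, by simpa [hc] using hq⟩, Nat.le_succ _⟩
  · set b := σ c * a / c
    have hb : C b * C c = C (σ c) * C a := by
      rw [← map_mul, ← map_mul, div_mul_cancel₀ _ hc]
    refine ⟨(X - C b) * f, H.mul_ne_zero' (H.X_sub_C_ne_zero b) hf, ⟨_, rfl⟩,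
      ⟨(X - C b) * q + C (σ c), ?_⟩, ?_⟩
    · nth_rw 1 [hq]
      rw [mul_add, sub_mul X (C b) (C c), H.X_mul_C, hb]
      noncomm_ring
    · rw [H.natDeg_mul (H.X_sub_C_ne_zero b) hf, H.natDeg_X_sub_C, add_comm]

lemma exists_common_left_multiple_finset {ι : Type*} [DecidableEq ι] (f : R) (hf : f ≠ 0)
    (a : ι → L) (s : Finset ι) :
    ∃ h, h ≠ 0 ∧ RDvd f h ∧ (∀ i ∈ s, RDvd (X - C (a i)) h) ∧
      H.natDeg h ≤ H.natDeg f + s.card := by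
  induction s using Finset.induction_on with
  | empty => exact ⟨f, hf, ⟨1, (one_mul f).symm⟩, by simp, by simp⟩
  | insert i s hi ih =>
    obtain ⟨h, h0, ⟨u, hu⟩, hs, hd⟩ := ih
    obtain ⟨h', h0', ⟨v, hv⟩, hi', hd'⟩ := H.exists_common_left_multiple h h0 (a i)
    refine ⟨h', h0', ⟨v * u, by rw [hv, hu, mul_assoc]⟩, fun j hj => ?_, ?_⟩
    · rcases Finset.mem_insert.mp hj with rfl | hj
      · exact hi'
      · obtain ⟨w, hw⟩ := hs j hj
        exact ⟨v * w, by rw [hv, hw, mul_assoc]⟩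
    · rw [Finset.card_insert_of_notMem hi]
      omega

lemma natDeg_le_of_rDvd {f h : R} (hh : h ≠ 0) (hd : RDvd f h) :
    f ≠ 0 ∧ H.natDeg f ≤ H.natDeg h := by
  obtain ⟨u, rfl⟩ := hd
  have hu : u ≠ 0 := by rintro rfl; simp at hh
  have hf : f ≠ 0 := by rintro rfl; simp at hh
  exact ⟨hf, by rw [H.natDeg_mul hu hf]; omega⟩

lemma one_ne_zero' : (1 : R) ≠ 0 := fun h =>
  H.X_sub_C_ne_zero 0 (by rw [← mul_one (X - C 0), h, mul_zero])

lemma natDeg_one : H.natDeg 1 = 0 := by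
  have := H.natDeg_mul H.one_ne_zero' H.one_ne_zero'
  rw [mul_one] at this
  omega

/-- A subfamily of a P-independent family is P-independent. -/
lemma natDeg_lclm_subfamily {n ν : ℕ} {α : Fin n → L} {k : Fin ν → Fin n}
    (hk : Function.Injective k) {lam Λ : R} (hlam : IsLclm (fun j => X - C (α (k j))) lam)
    (hΛ : IsLclm (fun i => X - C (α i)) Λ) (hdeg : H.deg Λ = n) :
    lam ≠ 0 ∧ H.natDeg lam = ν := by
  classical
  obtain ⟨h, h0, -, hs, hd⟩ :=
    H.exists_common_left_multiple_finset 1 H.one_ne_zero' (fun j => α (k j)) Finset.univ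
  obtain ⟨hne, hle⟩ := H.natDeg_le_of_rDvd h0 (hlam.2 h fun j => hs j (Finset.mem_univ j))
  obtain ⟨h', h0', ⟨u, hu⟩, hs', hd'⟩ :=
    H.exists_common_left_multiple_finset lam hne α (Finset.univ.image k)ᶜ
  have hdvd : RDvd Λ h' := by
    refine hΛ.2 h' fun i => ?_
    by_cases hi : i ∈ Finset.univ.image k
    · obtain ⟨j, -, rfl⟩ := Finset.mem_image.mp hi
      obtain ⟨w, hw⟩ := hlam.1 j
      exact ⟨u * w, by rw [hu, hw, mul_assoc]⟩
    · exact hs' i (Finset.mem_compl.mpr hi)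
  have hle' := (H.natDeg_le_of_rDvd h0' hdvd).2
  rw [H.natDeg_eq_of_deg_eq hdeg] at hle'
  rw [H.natDeg_one, Finset.card_univ, Fintype.card_fin] at hd
  rw [Finset.card_compl, Finset.card_image_of_injective _ hk, Finset.card_univ,
    Fintype.card_fin, Fintype.card_fin] at hd'
  have := Fintype.card_le_of_injective k hk
  simp only [Fintype.card_fin] at this
  exact ⟨hne, by omega⟩

end Lclm

section Cofactors

/-- The right linear combination of `ρ` with coefficients `c`. -/
def comb (C : L →+* R) {ν : ℕ} (ρ : Fin ν → R) (c : Fin ν → L) : R := ∑ j, ρ j * C (c j)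

lemma comb_add {ν : ℕ} (ρ : Fin ν → R) (c d : Fin ν → L) :
    comb C ρ (c + d) = comb C ρ c + comb C ρ d := by
  simp [comb, mul_add, Finset.sum_add_distrib]

lemma comb_sub {ν : ℕ} (ρ : Fin ν → R) (c d : Fin ν → L) :
    comb C ρ (c - d) = comb C ρ c - comb C ρ d := by
  simp [comb, mul_sub, Finset.sum_sub_distrib]

lemma comb_smul {ν : ℕ} (ρ : Fin ν → R) (c : Fin ν → L) (a : L) :
    comb C ρ (a • c) = comb C ρ c * C a := by
  simp [comb, Finset.sum_mul, mul_assoc, mul_comm a]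

lemma comb_single {ν : ℕ} (ρ : Fin ν → R) (j : Fin ν) : comb C ρ (Pi.single j 1) = ρ j := by
  rw [comb, Finset.sum_eq_single j] <;> simp +contextual

/-- The semilinear map by which right multiplication by `X` acts on coordinates with respect
to the cofactors of an lclm of the polynomials `X - C (a j)`. -/
def twistedShift (σ : L ≃+* L) {ν : ℕ} (a c : Fin ν → L) : Fin ν → L :=
  fun j => a j * σ.symm (c j)

variable (H : IsOreExtension σ (fun _ => 0) R C X) {ν : ℕ} {a : Fin ν → L} {lam : R}
  {ρ : Fin ν → R}

include H

lemma comb_mul_X (hρ : ∀ j, lam = ρ j * (X - C (a j))) (c : Fin ν → L) :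
    comb C ρ c * X = comb C ρ (twistedShift σ a c) + lam * ∑ j, C (σ.symm (c j)) := by
  simp only [comb, twistedShift]
  rw [Finset.sum_mul, Finset.mul_sum, ← Finset.sum_add_distrib]
  refine Finset.sum_congr rfl fun j _ => ?_
  rw [mul_assoc, H.C_mul_X_symm, map_mul]
  nth_rw 1 [hρ j]
  noncomm_ring

lemma exists_comb_mul (hρ : ∀ j, lam = ρ j * (X - C (a j))) (U : Submodule L (Fin ν → L))
    (hU : ∀ w ∈ U, twistedShift σ a w ∈ U) {w : Fin ν → L} (hw : w ∈ U) (f : R) :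
    ∃ w' ∈ U, ∃ b, comb C ρ w * f = comb C ρ w' + lam * b := by
  induction f using H.induction_right with
  | one => exact ⟨w, hw, 0, by simp⟩
  | add r s hr hs =>
    obtain ⟨w₁, h₁, b₁, e₁⟩ := hr
    obtain ⟨w₂, h₂, b₂, e₂⟩ := hs
    refine ⟨w₁ + w₂, U.add_mem h₁ h₂, b₁ + b₂, ?_⟩
    rw [mul_add, e₁, e₂, comb_add]
    noncomm_ring
  | mul_C r c hr =>
    obtain ⟨w₁, h₁, b₁, e₁⟩ := hr
    refine ⟨c • w₁, U.smul_mem c h₁, b₁ * C c, ?_⟩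
    rw [← mul_assoc, e₁, comb_smul]
    noncomm_ring
  | mul_X r hr =>
    obtain ⟨w₁, h₁, b₁, e₁⟩ := hr
    refine ⟨twistedShift σ a w₁, hU _ h₁, ∑ j, C (σ.symm (w₁ j)) + b₁ * X, ?_⟩
    rw [← mul_assoc, e₁, add_mul, H.comb_mul_X hρ]
    noncomm_ring

/-- The cofactors of an lclm span `R / lam R` as a right vector space. -/
lemma exists_eq_comb_add (hlam : IsLclm (fun j => X - C (a j)) lam) (hlam0 : lam ≠ 0)
    (hρ : ∀ j, lam = ρ j * (X - C (a j))) (r : R) :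
    ∃ c b, r = comb C ρ c + lam * b := by
  have := H.noZeroDivisors
  let P : R → Prop := fun r => ∃ c b, r = comb C ρ c + lam * b
  have mul_mem : ∀ r f, P r → P (r * f) := by
    rintro r f ⟨c, b, rfl⟩
    obtain ⟨c', -, b', h⟩ := H.exists_comb_mul hρ ⊤ (by simp) (Submodule.mem_top (x := c)) f
    exact ⟨c', b' + b * f, by rw [add_mul, h]; noncomm_ring⟩
  have sub_mem : ∀ r s, P r → P s → P (r - s) := by
    rintro _ _ ⟨c, b, rfl⟩ ⟨c', b', rfl⟩
    exact ⟨c - c', b - b', by rw [comb_sub]; noncomm_ring⟩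
  have lam_mem : P lam := ⟨0, 1, by simp [comb]⟩
  have rho_mem : ∀ j, P (ρ j) := fun j => ⟨Pi.single j 1, 0, by rw [comb_single]; simp⟩
  obtain ⟨d, ⟨hd, hd0⟩, hmin⟩ := exists_minimalFor_of_wellFoundedLT
    (fun r => P r ∧ r ≠ 0) H.natDeg ⟨lam, lam_mem, hlam0⟩
  have hdvd : ∀ r, P r → ∃ q, r = d * q := by
    intro r hr
    obtain ⟨q, r', rfl, h⟩ := H.exists_eq_mul_add hd0 r
    have hr' : P r' := by simpa using sub_mem _ _ hr (mul_mem d q hd)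
    rcases h with rfl | h
    · exact ⟨q, by simp⟩
    · by_cases h0 : r' = 0
      · exact ⟨q, by simp [h0]⟩
      · exact absurd (hmin ⟨hr', h0⟩ h.le) (not_le.mpr h)
  obtain ⟨s, hs⟩ := hdvd lam lam_mem
  obtain ⟨u, hu⟩ : RDvd lam s := by
    refine hlam.2 s fun j => ?_
    obtain ⟨t, ht⟩ := hdvd (ρ j) (rho_mem j)
    refine ⟨t, mul_left_cancel₀ hd0 ?_⟩
    rw [← mul_assoc, ← ht, ← hs, ← hρ]
  have hdu : d * u = 1 := by
    apply mul_right_cancel₀ hlam0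
    rw [mul_assoc, ← hu, ← hs, one_mul]
  have := mul_mem d (u * r) hd
  rwa [← mul_assoc, hdu, one_mul] at this

lemma coeffs_comb (c : Fin ν → L) (i : ℕ) :
    (⇑σ.symm)^[i] (H.coeffs (comb C ρ c) i) = ∑ j, c j * (⇑σ.symm)^[i] (H.coeffs (ρ j) i) := by
  have hli : Function.LeftInverse (⇑σ.symm)^[i] (⇑σ)^[i] :=
    Function.LeftInverse.iterate σ.symm_apply_apply i
  rw [comb, H.coeffs_sum, Finsupp.finsetSum_apply]
  simp_rw [H.coeffs_mul_C]
  have hsum := map_sum (σ.symm.toRingHom ^ i) (fun j => H.coeffs (ρ j) i * (⇑σ)^[i] (c j))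
    Finset.univ
  simp only [map_mul, RingHom.coe_pow] at hsum
  refine hsum.trans (Finset.sum_congr rfl fun j _ => ?_)
  rw [mul_comm]
  congr 1
  exact hli (c j)

lemma natDeg_cofactor_lt (hlam0 : lam ≠ 0) (hdeg : H.natDeg lam = ν)
    (hρ : ∀ j, lam = ρ j * (X - C (a j))) (j : Fin ν) : H.natDeg (ρ j) < ν := by
  have h0 : ρ j ≠ 0 := fun h => hlam0 (by rw [hρ j, h, zero_mul])
  have := H.natDeg_mul h0 (H.X_sub_C_ne_zero (a j))
  rw [← hρ j, hdeg, H.natDeg_X_sub_C] at this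
  omega

lemma coeffs_comb_eq_zero (hlam0 : lam ≠ 0) (hdeg : H.natDeg lam = ν)
    (hρ : ∀ j, lam = ρ j * (X - C (a j))) (c : Fin ν → L) {i : ℕ} (hi : ν ≤ i) :
    H.coeffs (comb C ρ c) i = 0 := by
  rw [comb, H.coeffs_sum, Finsupp.finsetSum_apply]
  refine Finset.sum_eq_zero fun j _ => ?_
  rw [H.coeffs_mul_C, H.coeffs_eq_zero_of_natDeg_lt, zero_mul]
  exact (H.natDeg_cofactor_lt hlam0 hdeg hρ j).trans_le hi

lemma eq_zero_of_coeffs_mul_eq_zero (hlam0 : lam ≠ 0) {b : R}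
    (h : ∀ i, H.natDeg lam ≤ i → H.coeffs (lam * b) i = 0) : b = 0 := by
  by_contra hb
  exact H.coeffs_mul_natDeg_add_ne_zero hlam0 hb (h _ (Nat.le_add_right _ _))

/-- The cofactors of an lclm of full degree are right linearly independent modulo `lam R`. -/
lemma eq_zero_of_comb_eq (hlam : IsLclm (fun j => X - C (a j)) lam) (hlam0 : lam ≠ 0)
    (hdeg : H.natDeg lam = ν) (hρ : ∀ j, lam = ρ j * (X - C (a j)))
    {c : Fin ν → L} {b : R} (h : comb C ρ c = lam * b) : c = 0 := by
  let T : (Fin ν → L) →ₗ[L] (Fin ν → L) := (Matrix.of fun i j : Fin ν =>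
    (⇑σ.symm)^[(i : ℕ)] (H.coeffs (ρ j) i)).mulVecLin
  have hT : ∀ c i, T c i = (⇑σ.symm)^[(i : ℕ)] (H.coeffs (comb C ρ c) i) := by
    intro c i
    rw [H.coeffs_comb]
    simp [T, Matrix.mulVec, dotProduct, mul_comm]
  have hz : ∀ i, (⇑σ.symm)^[i] 0 = 0 := fun i => Function.iterate_fixed (map_zero σ.symm) i
  have hsurj : Function.Surjective T := by
    intro v
    set f : R := ∑ i : Fin ν, C ((⇑σ)^[(i : ℕ)] (v i)) * X ^ (i : ℕ)
    have hf : ∀ m, H.coeffs f m =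
        ∑ i : Fin ν, if (i : ℕ) = m then (⇑σ)^[(i : ℕ)] (v i) else 0 := by
      intro m
      simp only [f, H.coeffs_sum, H.coeffs_monomial, Finsupp.finsetSum_apply,
        Finsupp.single_apply]
    obtain ⟨c, b, hcb⟩ := H.exists_eq_comb_add hlam hlam0 hρ f
    have hb : b = 0 := by
      refine H.eq_zero_of_coeffs_mul_eq_zero hlam0 fun m hm => ?_
      rw [hdeg] at hm
      rw [← sub_eq_iff_eq_add'.mpr hcb, H.coeffs_sub, Finsupp.sub_apply,
        H.coeffs_comb_eq_zero hlam0 hdeg hρ c hm, hf, sub_zero]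
      exact Finset.sum_eq_zero fun i _ => if_neg (by omega)
    rw [hb, mul_zero, add_zero] at hcb
    refine ⟨c, funext fun i => ?_⟩
    rw [hT, ← hcb, hf, Finset.sum_eq_single i (fun j _ hj => if_neg (by omega)) (by simp),
      if_pos rfl]
    exact Function.LeftInverse.iterate σ.symm_apply_apply i (v i)
  have hb : b = 0 := H.eq_zero_of_coeffs_mul_eq_zero hlam0 fun m hm => by
    rw [← h, H.coeffs_comb_eq_zero hlam0 hdeg hρ c (hdeg ▸ hm)]
  apply LinearMap.injective_iff_surjective.mpr hsurj
  refine funext fun i => ?_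
  rw [hT, h, hb, mul_zero, H.coeffs_zero, map_zero, Finsupp.zero_apply, Pi.zero_apply, hz]

end Cofactors

end IsOreExtension

/-- If the orbit of a vector under an additive semilinear map spans a space of dimension `ν`,
then its first `ν` terms are linearly independent. -/
lemma linearIndependent_iterate_of_span_eq_top {L V : Type*} [Field L] [AddCommGroup V]
    [Module L V] (τ : L →+* L) (T : V →ₛₗ[τ] V) (v : ℕ → V) (hv : ∀ i, v (i + 1) = T (v i))
    (hspan : Submodule.span L (Set.range v) = ⊤) (m : ℕ) (hm : m ≤ Module.finrank L V) :
    LinearIndependent L fun i : Fin m => v i := by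
  induction m with
  | zero => exact linearIndependent_empty_type
  | succ m ih =>
    rw [linearIndependent_finSucc']
    refine ⟨ih (by omega), fun hmem => ?_⟩
    set W := Submodule.span L (Set.range (Fin.init fun i : Fin (m + 1) => v i)) with hW
    have hvW : ∀ i < m, v i ∈ W := fun i hi => Submodule.subset_span ⟨⟨i, hi⟩, rfl⟩
    have hmem' : v m ∈ W := hmem
    have hTW : W ≤ W.comap T := by
      rw [hW, Submodule.span_le]
      rintro _ ⟨i, rfl⟩
      change T (v i) ∈ W
      rw [← hv]
      rcases (Nat.succ_le_of_lt i.isLt).eq_or_lt with h | h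
      · rwa [show (i : ℕ) + 1 = m from h]
      · exact hvW _ h
    have hall : ∀ i, v i ∈ W := by
      intro i
      induction i with
      | zero =>
        rcases Nat.eq_zero_or_pos m with h | h
        · rwa [h] at hmem'
        · exact hvW 0 h
      | succ i hi => exact hv i ▸ hTW hi
    have htop : W = ⊤ := top_le_iff.mp (hspan ▸ Submodule.span_le.mpr (by
      rintro _ ⟨i, rfl⟩
      exact hall i))
    have hle : Module.finrank L W ≤ m := by
      simpa [Set.finrank] using finrank_range_le_card (R := L) (Fin.init fun i : Fin (m + 1) => v i)
    rw [htop, finrank_top] at hle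
    omega

/-- Proposition 23 of the paper: `gcld (ω, lam) = 1` iff the `ν × ν` matrix with
entries `N_{-i}(α (k j)) * σ^{-i}(η (k j)) * σ^{-i}(e (k j))` has nonzero
determinant. -/
theorem gcld_one_iff_det_ne_zero
    {L : Type*} [Field L] (σ : L ≃+* L) (μ : ℕ) (hμ : 0 < μ)
    (hord : ∀ a : L, (⇑σ)^[μ] a = a)
    (hord' : ∀ i : ℕ, 0 < i → i < μ → ∃ a : L, (⇑σ)^[i] a ≠ a)
    {R : Type*} [Ring R] (C : L →+* R) (X : R)
    (H : IsOreExtension σ (fun _ => 0) R C X)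
    (F : Subfield L) (n : ℕ) (α : Fin n → L) (hα : Function.Injective α)
    (g : R) (hg0 : g ≠ 0)
    (hginv : ∀ a : R, ∃ b : R, a * g = g * b) (hginv' : ∀ a : R, ∃ b : R, g * a = b * g)
    (hcop : ∀ i, RCoprime (X - C (α i)) g)
    (η : Fin n → L) (hη : ∀ i, η i ≠ 0)
    (e : Fin n → L) (heF : ∀ i, e i ∈ F)
    (ν : ℕ) (k : Fin ν → Fin n) (hk : Function.Injective k)
    (hek : ∀ j, e (k j) ≠ 0) (hesupp : ∀ i, (∀ j, k j ≠ i) → e i = 0)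
    (lam : R) (hlam : IsLclm (fun j : Fin ν => X - C (α (k j))) lam)
    (ρ : Fin ν → R) (hρ : ∀ j, lam = ρ j * (X - C (α (k j))))
    (ω : R) (hω : ω = ∑ j, ρ j * C (η (k j)) * C (e (k j)))
    (Pind : ∃ Λ : R, IsLclm (fun i : Fin n => X - C (α i)) Λ ∧ H.deg Λ = (n : WithBot ℕ))
    :
    LCoprime ω lam ↔
      (Matrix.of fun (i j : Fin ν) =>
        Nneg σ (i : ℕ) (α (k j)) * (⇑σ.symm)^[(i : ℕ)] (η (k j)) *
          (⇑σ.symm)^[(i : ℕ)] (e (k j))).det ≠ 0 := by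
  obtain ⟨Λ, hΛ, hdegΛ⟩ := Pind
  obtain ⟨hlam0, hdeg⟩ := H.natDeg_lclm_subfamily hk hlam hΛ hdegΛ
  let a : Fin ν → L := fun j => α (k j)
  let v : ℕ → Fin ν → L := fun i j => Nneg σ i (α (k j)) * (⇑σ.symm)^[i] (η (k j)) *
    (⇑σ.symm)^[i] (e (k j))
  have hv : ∀ i, v (i + 1) = IsOreExtension.twistedShift σ a (v i) := by
    intro i
    funext j
    simp only [v, a, IsOreExtension.twistedShift, Nneg, Finset.prod_range_succ', map_mul,
      map_prod, Function.iterate_succ_apply', Function.iterate_zero, id]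
    ring
  let T : (Fin ν → L) →ₛₗ[(σ.symm : L →+* L)] (Fin ν → L) :=
    { toFun := IsOreExtension.twistedShift σ a
      map_add' := fun x y => by
        funext j
        simp [IsOreExtension.twistedShift, mul_add]
      map_smul' := fun c x => by
        funext j
        simp [IsOreExtension.twistedShift, mul_left_comm] }
  have hω' : ω = IsOreExtension.comb C ρ (v 0) := by
    simp [hω, IsOreExtension.comb, v, Nneg, mul_assoc]
  set U := Submodule.span L (Set.range v) with hUdef
  have hU : ∀ w ∈ U, IsOreExtension.twistedShift σ a w ∈ U := by
    have : U ≤ U.comap T := by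
      rw [hUdef, Submodule.span_le]
      rintro _ ⟨i, rfl⟩
      exact Submodule.subset_span ⟨i + 1, hv i⟩
    exact fun w hw => this hw
  change _ ↔ (Matrix.of fun (i : Fin ν) => v i).det ≠ 0
  rw [← isUnit_iff_ne_zero, ← Matrix.isUnit_iff_isUnit_det]
  constructor
  · rintro ⟨p, q, hpq⟩
    have hmem : ∀ j, (Pi.single j 1 : Fin ν → L) ∈ U := by
      intro j
      obtain ⟨w, hw, b, hb⟩ := H.exists_comb_mul (a := a) hρ U hU
        (Submodule.subset_span ⟨0, rfl⟩ : v 0 ∈ U) (p * ρ j)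
      have hsub : IsOreExtension.comb C ρ (Pi.single j 1 - w) = lam * (b + q * ρ j) := by
        rw [IsOreExtension.comb_sub, IsOreExtension.comb_single, sub_eq_iff_eq_add]
        calc ρ j = (ω * p + lam * q) * ρ j := by rw [hpq, one_mul]
          _ = ω * (p * ρ j) + lam * (q * ρ j) := by noncomm_ring
          _ = _ := by rw [hω', hb]; noncomm_ring
      rw [sub_eq_zero.mp (H.eq_zero_of_comb_eq hlam hlam0 hdeg hρ hsub)]
      exact hw
    have htop : U = ⊤ := by
      rw [← top_le_iff, ← (Pi.basisFun L (Fin ν)).span_eq, Submodule.span_le]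
      rintro _ ⟨j, rfl⟩
      simpa using hmem j
    rw [← Matrix.linearIndependent_rows_iff_isUnit]
    exact linearIndependent_iterate_of_span_eq_top _ T v hv htop ν (by simp)
  · intro hM
    obtain ⟨c, b, hcb⟩ := H.exists_eq_comb_add hlam hlam0 hρ 1
    let W : Submodule L (Fin ν → L) :=
      { carrier := {w | ∃ p q, IsOreExtension.comb C ρ w = ω * p + lam * q}
        zero_mem' := ⟨0, 0, by simp [IsOreExtension.comb]⟩
        add_mem' := by
          rintro x y ⟨p, q, h⟩ ⟨p', q', h'⟩
          exact ⟨p + p', q + q', by rw [IsOreExtension.comb_add, h, h']; noncomm_ring⟩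
        smul_mem' := by
          rintro s x ⟨p, q, h⟩
          exact ⟨p * C s, q * C s, by rw [IsOreExtension.comb_smul, h]; noncomm_ring⟩ }
    have hvW : ∀ i, v i ∈ W := by
      intro i
      induction i with
      | zero => exact ⟨1, 0, by rw [hω']; simp⟩
      | succ i ih =>
        obtain ⟨p, q, h⟩ := ih
        refine ⟨p * X, q * X - ∑ j, C (σ.symm (v i j)), ?_⟩
        rw [hv, eq_sub_of_add_eq (H.comb_mul_X (a := a) hρ (v i)).symm, h]
        noncomm_ring
    obtain ⟨d, rfl⟩ := Matrix.vecMul_surjective_iff_isUnit.mpr hM c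
    have hcW : Matrix.vecMul d (Matrix.of fun i : Fin ν => v i) ∈ W := by
      rw [Matrix.vecMul_eq_sum]
      exact W.sum_mem fun i _ => W.smul_mem _ (hvW i)
    obtain ⟨p, q, h⟩ := hcW
    exact ⟨p, q + b, by rw [hcb, h]; noncomm_ring⟩
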